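/- Fix (α, β, θ) ∈ (0,1)³ with α < η^hyp_θ(β). Then as p → ∞: (i) if α < η^{hyp,1}_θ(β), then Err(T̂_*^{(sa)}) → 0; (ii) if α < η^{hyp,2}_θ(β) and N = ⌈pε_p⌉, then Err(T̂_N^{(sa)}) → 0. -/

import Mathlib

open MeasureTheory ProbabilityTheory Filter
open scoped ENNReal NNReal Classical BigOperators

namespace ARWPaper

/-- `n = ⌈p^θ⌉`. -/
noncomputable def nDim (p : ℕ) (θ : ℝ) : ℕ := ⌈(p : ℝ) ^ θ⌉₊

/-- Law of a single class label: uniform on `{-1, 1}`. -/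
noncomputable def signLaw : Measure ℝ :=
  (1 / 2 : ℝ≥0∞) • Measure.dirac (1 : ℝ) + (1 / 2 : ℝ≥0∞) • Measure.dirac (-1 : ℝ)

/-- Law of a single coordinate of `μ`: `τ` w.p. `ε`, `0` w.p. `1 - ε`. -/
noncomputable def muLaw (ε τ : ℝ) : Measure ℝ :=
  ENNReal.ofReal (1 - ε) • Measure.dirac (0 : ℝ) + ENNReal.ofReal ε • Measure.dirac τ

/-- Standard Gaussian product measure on `ℝ^n`. -/
noncomputable def gaussPi (n : ℕ) : Measure (Fin n → ℝ) :=
  Measure.pi fun _ => gaussianReal 0 1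

/-- Law of the noise matrix `Z` (i.i.d. `N(0,1)` entries, rows indexed by `Fin n`). -/
noncomputable def noiseLaw (n p : ℕ) : Measure (Fin n → Fin p → ℝ) :=
  Measure.pi fun _ => gaussPi p

/-- Sample space for `(ℓ, μ, Z)`. -/
abbrev Omega (n p : ℕ) := (Fin n → ℝ) × (Fin p → ℝ) × (Fin n → Fin p → ℝ)

/-- Joint law of `(ℓ, μ, Z)`. -/
noncomputable def jointLaw (n p : ℕ) (ε τ : ℝ) : Measure (Omega n p) :=
  (Measure.pi fun _ : Fin n => signLaw).prod
    ((Measure.pi fun _ : Fin p => muLaw ε τ).prod (noiseLaw n p))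

/-- Data matrix `X = ℓ μ' + Z`. -/
def dataMap {n p : ℕ} (ω : Omega n p) : Fin n → Fin p → ℝ :=
  fun i j => ω.1 i * ω.2.1 j + ω.2.2 i j

/-- Hamming clustering error of a clustering procedure `ell`, where the observed data
matrix is `D ω`. -/
noncomputable def hammingClu (n p : ℕ) (ε τ : ℝ)
    (D : Omega n p → Fin n → Fin p → ℝ)
    (ell : (Fin n → Fin p → ℝ) → Fin n → ℝ) : ℝ :=
  (n : ℝ)⁻¹ * min
    (∑ i : Fin n, ((jointLaw n p ε τ) {ω | ell (D ω) i ≠ ω.1 i}).toReal)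
    (∑ i : Fin n, ((jointLaw n p ε τ) {ω | ell (D ω) i ≠ -ω.1 i}).toReal)

/-- Hamming error for signal (support) recovery. -/
noncomputable def hammingSig (n p : ℕ) (ε τ : ℝ)
    (D : Omega n p → Fin n → Fin p → ℝ)
    (S : (Fin n → Fin p → ℝ) → Finset (Fin p)) : ℝ :=
  ((p : ℝ) * ε)⁻¹ * ∑ j : Fin p,
    (((jointLaw n p ε τ) {ω | ω.2.1 j = 0 ∧ j ∈ S (D ω)}).toReal +
      ((jointLaw n p ε τ) {ω | ω.2.1 j ≠ 0 ∧ j ∉ S (D ω)}).toReal)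

/-- Sum of type I and type II testing errors of the rejection region `R`. -/
noncomputable def testErr (n p : ℕ) (ε τ : ℝ)
    (R : Set (Fin n → Fin p → ℝ)) : ℝ :=
  ((noiseLaw n p) R).toReal + ((jointLaw n p ε τ) {ω | dataMap ω ∉ R}).toReal

/-- Statistical boundary for clustering. -/
noncomputable def etaClu (θ β : ℝ) : ℝ :=
  if β < (1 - θ) / 2 then (1 - 2 * β) / 2
  else if β < 1 - θ then θ / 2
  else (1 - β) / 2

/-- CTUB boundary for clustering. -/
noncomputable def etaCluT (θ β : ℝ) : ℝ :=
  if β < (1 - θ) / 2 then (1 - 2 * β) / 2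
  else if β < 1 / 2 then (1 + θ - 2 * β) / 4
  else if β < 1 - θ / 2 then θ / 4
  else (1 - β) / 2

/-- Statistical boundary for signal recovery. -/
noncomputable def etaSig (θ β : ℝ) : ℝ :=
  if β < 1 - θ then θ / 2 else (1 + θ - β) / 4

/-- CTUB boundary for signal recovery. -/
noncomputable def etaSigT (θ β : ℝ) : ℝ :=
  if β < (1 - θ) / 2 then θ / 2
  else if β < 1 / 2 then (1 + θ - 2 * β) / 4
  else θ / 4

noncomputable def etaHyp1 (θ β : ℝ) : ℝ := (2 + θ - 4 * β) / 4
noncomputable def etaHyp2 (θ β : ℝ) : ℝ := min (θ / 2) ((1 + θ - β) / 4)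
noncomputable def etaHyp (θ β : ℝ) : ℝ := max (etaHyp1 θ β) (etaHyp2 θ β)
noncomputable def etaHypT (θ β : ℝ) : ℝ := max (etaHyp1 θ β) (θ / 4)

/-- Standard phase function `ρ*`. -/
noncomputable def rhoStar (b : ℝ) : ℝ :=
  if b < 3 / 4 then b - 1 / 2 else (1 - Real.sqrt (1 - b)) ^ 2

/-- Phase function for IF-PCA. -/
noncomputable def rhoStarTheta (θ β : ℝ) : ℝ :=
  (1 - θ) * rhoStar (1 / 2 + (β - 1 / 2) / (1 - θ))

/-- Euclidean norm of a vector. -/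
noncomputable def l2 {n : ℕ} (v : Fin n → ℝ) : ℝ := Real.sqrt (∑ i, v i ^ 2)

/-- Entrywise sup-norm of a vector. -/
noncomputable def linf {n : ℕ} (v : Fin n → ℝ) : ℝ := ⨆ i, |v i|

/-- `cos(x, y) = |⟨x/‖x‖, y/‖y‖⟩|`. -/
noncomputable def cosv {n : ℕ} (x y : Fin n → ℝ) : ℝ :=
  |∑ i, x i * y i| / (l2 x * l2 y)

/-- Spectral (operator) norm of a matrix. -/
noncomputable def specNorm {m k : ℕ} (A : Matrix (Fin m) (Fin k) ℝ) : ℝ :=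
  sSup ((fun v => l2 (A.mulVec v)) '' {v | l2 v ≤ 1})

/-- Simple Aggregation clustering: entrywise sign of the sum of all columns. -/
noncomputable def ellSimpleAgg {n p : ℕ} (X : Fin n → Fin p → ℝ) : Fin n → ℝ :=
  fun i => Real.sign (∑ j, X i j)

/-- `S` picks, for every data matrix, a size-`N` subset maximizing `‖∑_{j ∈ S} x_j‖₁`. -/
def IsSparseAggMaximizer {n p : ℕ} (N : ℕ)
    (S : (Fin n → Fin p → ℝ) → Finset (Fin p)) : Prop :=
  ∀ X, (S X).card = N ∧
    ∀ T : Finset (Fin p), T.card = N →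
      ∑ i, |∑ j ∈ T, X i j| ≤ ∑ i, |∑ j ∈ S X, X i j|

/-- Sparse Aggregation clustering. -/
noncomputable def ellSparseAgg {n p : ℕ}
    (S : (Fin n → Fin p → ℝ) → Finset (Fin p)) (X : Fin n → Fin p → ℝ) :
    Fin n → ℝ :=
  fun i => Real.sign (∑ j ∈ S X, X i j)

/-- Gram matrix `X X'`. -/
def gram {n p : ℕ} (X : Fin n → Fin p → ℝ) : Matrix (Fin n) (Fin n) ℝ :=
  Matrix.of fun i i' => ∑ j, X i j * X i' j

/-- `ξ` is a unit eigenvector of `A` associated with its largest eigenvalue. -/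
def IsTopEigenvector {n : ℕ} (A : Matrix (Fin n) (Fin n) ℝ) (ξ : Fin n → ℝ) : Prop :=
  (∑ i, ξ i ^ 2) = 1 ∧
    ∃ lam : ℝ, A.mulVec ξ = lam • ξ ∧
      ∀ (lam' : ℝ) (v : Fin n → ℝ), v ≠ 0 → A.mulVec v = lam' • v → lam' ≤ lam

/-- χ²-screening: the set of selected features. -/
noncomputable def chiSel {n p : ℕ} (q : ℝ) (X : Fin n → Fin p → ℝ) : Finset (Fin p) :=
  Finset.univ.filter fun j =>
    Real.sqrt (2 * q * Real.log p) ≤ ((∑ i, X i j ^ 2) - n) / Real.sqrt (2 * n)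

/-- Post-selection Gram matrix `X^{(q)} (X^{(q)})'`. -/
noncomputable def gramSel {n p : ℕ} (q : ℝ) (X : Fin n → Fin p → ℝ) :
    Matrix (Fin n) (Fin n) ℝ :=
  Matrix.of fun i i' => ∑ j ∈ chiSel q X, X i j * X i' j

/-- IF-PCA calibration `τ_p* = p^{-θ/4} (4 r log p)^{1/4}`. -/
noncomputable def tauStar (p : ℕ) (θ r : ℝ) : ℝ :=
  (p : ℝ) ^ (-(θ / 4)) * (4 * r * Real.log p) ^ ((1 : ℝ) / 4)

/-- The ideal threshold `q*` of IF-PCA in the Region of Possibility. -/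
noncomputable def qStar (θ β r : ℝ) : ℝ :=
  if (β - θ / 2) / 3 < r then (β - θ / 2 + r) ^ 2 / (4 * r) else 4 * r

/-- Support of `μ`. -/
noncomputable def suppSet {p : ℕ} (μ : Fin p → ℝ) : Finset (Fin p) :=
  Finset.univ.filter fun j => μ j ≠ 0

/-- The event `D_p`: `| |S(μ)| - p ε_p | ≤ √(6 p ε_p log p)` with `ε_p = p^{-β}`. -/
def inDp (β : ℝ) {p : ℕ} (μ : Fin p → ℝ) : Prop :=
  |((suppSet μ).card : ℝ) - (p : ℝ) * (p : ℝ) ^ (-β)| ≤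
    Real.sqrt (6 * ((p : ℝ) * (p : ℝ) ^ (-β)) * Real.log p)

/-- Selection threshold `n + 2√(q n log p)` for the squared column norm. -/
noncomputable def thresh (p n : ℕ) (q : ℝ) : ℝ :=
  (n : ℝ) + 2 * Real.sqrt (q * n * Real.log p)

/-- `π₀ = P(‖z‖² > n + 2√(q n log p))`, `z ~ N(0, I_n)`. -/
noncomputable def pi0 (p n : ℕ) (q : ℝ) : ℝ :=
  ((gaussPi n) {z | thresh p n q < ∑ i, z i ^ 2}).toReal

/-- `π₁ = P(‖z + τ ℓ‖² > n + 2√(q n log p))`, `z ~ N(0, I_n)`. -/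
noncomputable def pi1 (p : ℕ) {n : ℕ} (q τ : ℝ) (ℓ : Fin n → ℝ) : ℝ :=
  ((gaussPi n) {z | thresh p n q < ∑ i, (z i + τ * ℓ i) ^ 2}).toReal

/-- Expected number of selected useless features (`s = |S(μ)|`). -/
noncomputable def m0q (p n : ℕ) (q : ℝ) (s : ℕ) : ℝ := ((p : ℝ) - s) * pi0 p n q

/-- Expected number of selected useful features. -/
noncomputable def m1q (p : ℕ) {n : ℕ} (q τ : ℝ) (ℓ : Fin n → ℝ) (s : ℕ) : ℝ :=
  (s : ℝ) * pi1 p q τ ℓ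

/-- `m^{(q)}`. -/
noncomputable def mq (p : ℕ) {n : ℕ} (q τ : ℝ) (ℓ : Fin n → ℝ) (s : ℕ) : ℝ :=
  m0q p n q s + m1q p q τ ℓ s

/-- `m_*^{(q)}`. -/
noncomputable def mstarq (p : ℕ) {n : ℕ} (q τ : ℝ) (ℓ : Fin n → ℝ) (s : ℕ) : ℝ :=
  ((p : ℝ) - s) * (n : ℝ)⁻¹ *
      (∫ z in {z : Fin n → ℝ | thresh p n q < ∑ i, z i ^ 2}, (∑ i, z i ^ 2) ∂gaussPi n) +
    (s : ℝ) * (n : ℝ)⁻¹ *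
      (∫ z in {z : Fin n → ℝ | thresh p n q < ∑ i, (z i + τ * ℓ i) ^ 2},
        (∑ i, z i ^ 2) ∂gaussPi n)

/-- The threshold `q̃(β, θ, r)` separating the "fat" and "skinny" cases. -/
noncomputable def qTilde (β θ r : ℝ) : ℝ :=
  if β < 1 - θ then max (1 - θ) ((Real.sqrt (1 - β - θ) + Real.sqrt r) ^ 2)
  else 1 - θ

/-- The set of features selected by χ²-screening, in terms of `(ℓ, μ, Z)`. -/
noncomputable def selSet {n p : ℕ} (q : ℝ) (ℓ : Fin n → ℝ) (μ : Fin p → ℝ)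
    (Z : Fin n → Fin p → ℝ) : Finset (Fin p) :=
  chiSel q fun i j => ℓ i * μ j + Z i j

/-- `Z^{(q)} (Z^{(q)})'`. -/
noncomputable def gramZq {n p : ℕ} (q : ℝ) (ℓ : Fin n → ℝ) (μ : Fin p → ℝ)
    (Z : Fin n → Fin p → ℝ) : Matrix (Fin n) (Fin n) ℝ :=
  Matrix.of fun i i' => ∑ j ∈ selSet q ℓ μ Z, Z i j * Z i' j

/-- `X^{(q)} (X^{(q)})'`. -/
noncomputable def gramXq {n p : ℕ} (q : ℝ) (ℓ : Fin n → ℝ) (μ : Fin p → ℝ)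
    (Z : Fin n → Fin p → ℝ) : Matrix (Fin n) (Fin n) ℝ :=
  Matrix.of fun i i' =>
    ∑ j ∈ selSet q ℓ μ Z, (ℓ i * μ j + Z i j) * (ℓ i' * μ j + Z i' j)

/-- The matrix `ℓ (μ^{(q)})' (Z^{(q)})' + Z^{(q)} μ^{(q)} ℓ'`. -/
noncomputable def crossMat {n p : ℕ} (q : ℝ) (ℓ : Fin n → ℝ) (μ : Fin p → ℝ)
    (Z : Fin n → Fin p → ℝ) : Matrix (Fin n) (Fin n) ℝ :=
  Matrix.of fun i i' =>
    ℓ i * (∑ j ∈ selSet q ℓ μ Z, Z i' j * μ j) +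
      (∑ j ∈ selSet q ℓ μ Z, Z i j * μ j) * ℓ i'

/-- Colored-noise data matrix `X = ℓ μ' + A Z B`. -/
noncomputable def dataColored {n p : ℕ} (A : Matrix (Fin n) (Fin n) ℝ)
    (B : Matrix (Fin p) (Fin p) ℝ) (ω : Omega n p) : Fin n → Fin p → ℝ :=
  fun i j => ω.1 i * ω.2.1 j + (A * Matrix.of ω.2.2 * B) i j

/-- Colored-noise data matrix `X = ℓ μ' + Z B`. -/
noncomputable def dataColoredB {n p : ℕ} (B : Matrix (Fin p) (Fin p) ℝ)
    (ω : Omega n p) : Fin n → Fin p → ℝ :=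
  fun i j => ω.1 i * ω.2.1 j + (Matrix.of ω.2.2 * B) i j

/-- `y_*^{(sa)} = n^{-1/2} X' ℓ̂_*^{(sa)}`. -/
noncomputable def ySA {n p : ℕ} (X : Fin n → Fin p → ℝ) : Fin p → ℝ :=
  fun j => (Real.sqrt n)⁻¹ * ∑ i, X i j * ellSimpleAgg X i

/-- `Ŝ_*^{(sa)}`: thresholding `y_*^{(sa)}` at the universal threshold. -/
noncomputable def ShatSA {n p : ℕ} (X : Fin n → Fin p → ℝ) : Finset (Fin p) :=
  Finset.univ.filter fun j => Real.sqrt (2 * Real.log p) ≤ |ySA X j|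

/-- `y_*^{(if)} = n^{-1/2} X' sgn(ξ)` for a given vector `ξ`. -/
noncomputable def yIF {n p : ℕ} (ξ : Fin n → ℝ) (X : Fin n → Fin p → ℝ) : Fin p → ℝ :=
  fun j => (Real.sqrt n)⁻¹ * ∑ i, X i j * Real.sign (ξ i)

/-- `Ŝ_*^{(if)}`: thresholding `y_*^{(if)}` at the universal threshold. -/
noncomputable def ShatIF {n p : ℕ} (ξ : Fin n → ℝ) (X : Fin n → Fin p → ℝ) : Finset (Fin p) :=
  Finset.univ.filter fun j => Real.sqrt (2 * Real.log p) ≤ |yIF ξ X j|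

/-- Rejection region of the Simple Aggregation test `T̂_*^{(sa)}`. -/
noncomputable def rejSA {n p : ℕ} : Set (Fin n → Fin p → ℝ) :=
  {X | 2 * Real.sqrt (2 * Real.log p) ≤
    ((p : ℝ) * (∑ i, ((p : ℝ)⁻¹ * ∑ j, X i j) ^ 2) - n) / Real.sqrt (2 * n)}

/-- Rejection region of the Sparse Aggregation test `T̂_N^{(sa)}`. -/
noncomputable def rejSparse {n p : ℕ} (N : ℕ)
    (S : (Fin n → Fin p → ℝ) → Finset (Fin p)) : Set (Fin n → Fin p → ℝ) :=
  {X | Real.sqrt (2 / Real.pi) * n + Real.sqrt (2 * n * (N + 2) * Real.log p) ≤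
    (Real.sqrt N)⁻¹ * ∑ i, |∑ j ∈ S X, X i j|}

/-- χ² P-value of feature `j`. -/
noncomputable def pvalue {n p : ℕ} (X : Fin n → Fin p → ℝ) (j : Fin p) : ℝ :=
  ((gaussPi n) {z | (∑ i, X i j ^ 2) ≤ ∑ i, z i ^ 2}).toReal

/-- Higher Criticism statistic. -/
noncomputable def HCstat {n p : ℕ} (X : Fin n → Fin p → ℝ) : ℝ :=
  sSup {h : ℝ | ∃ i : Fin p, 2 * (i.val + 1) ≤ p ∧
    h = Real.sqrt p * (((i.val : ℝ) + 1) / p - pvalue X (Tuple.sort (pvalue X) i)) /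
      Real.sqrt (pvalue X (Tuple.sort (pvalue X) i) *
        (1 - pvalue X (Tuple.sort (pvalue X) i)))}

/-- Rejection region of the Higher Criticism test. -/
noncomputable def rejHC {n p : ℕ} : Set (Fin n → Fin p → ℝ) :=
  {X | 2 * Real.sqrt (2 * Real.log (Real.log p)) ≤ HCstat X}

/-- Lebesgue measure on the space of `n × p` matrices. -/
noncomputable def lebPi (n p : ℕ) : Measure (Fin n → Fin p → ℝ) :=
  Measure.pi fun _ : Fin n => Measure.pi fun _ : Fin p => (volume : Measure ℝ)

/-- Law of `X` in Experiment 1 (`X = ℓ μ' + c_p Z`) with `ℓ_i` forced to be `s`. -/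
noncomputable def condLaw1 (n p : ℕ) (ε τ cp : ℝ) (i : Fin n) (s : ℝ) :
    Measure (Fin n → Fin p → ℝ) :=
  (jointLaw n p ε τ).map fun ω => fun i' j =>
    Function.update ω.1 i s i' * ω.2.1 j + cp * ω.2.2 i' j

/-- Law of `X` in Experiment 2 (`X = ℓ μ' + c_p Z + W`) with `ℓ_i` forced to be `s`,
where `W ~ ν` is independent of `(ℓ, μ, Z)`. -/
noncomputable def condLaw2 (n p : ℕ) (ε τ cp : ℝ)
    (ν : Measure (Fin n → Fin p → ℝ)) (i : Fin n) (s : ℝ) :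
    Measure (Fin n → Fin p → ℝ) :=
  ((jointLaw n p ε τ).prod ν).map fun ωw => fun i' j =>
    Function.update ωw.1.1 i s i' * ωw.1.2.1 j + cp * ωw.1.2.2 i' j + ωw.2 i' j

end ARWPaper

namespace ARWPaper

instance : IsProbabilityMeasure signLaw := by
  constructor
  simp [signLaw, ENNReal.inv_two_add_inv_two]

lemma isProbabilityMeasure_muLaw {ε τ : ℝ} (h0 : 0 ≤ ε) (h1 : ε ≤ 1) :
    IsProbabilityMeasure (muLaw ε τ) := by
  constructor
  simp only [muLaw, Measure.coe_add, Measure.coe_smul, Pi.add_apply, Pi.smul_apply,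
    measure_univ, smul_eq_mul, mul_one]
  rw [← ENNReal.ofReal_add (by linarith) h0]
  simp

instance (n : ℕ) : IsProbabilityMeasure (gaussPi n) := by
  unfold gaussPi; infer_instance

instance (n p : ℕ) : IsProbabilityMeasure (noiseLaw n p) := by
  unfold noiseLaw; infer_instance

section ProductMeasure

variable {ι : Type*} [Fintype ι] {ν : ι → Measure ℝ} [∀ i, IsProbabilityMeasure (ν i)]
  {f : ι → ℝ → ℝ}

lemma memLp_sum_pi (hf : ∀ i, MemLp (f i) 2 (ν i)) :
    MemLp (fun ω : ι → ℝ => ∑ i, f i (ω i)) 2 (Measure.pi ν) :=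
  memLp_finsetSum _ fun i _ => (hf i).comp_measurePreserving (measurePreserving_eval _ i)

lemma integral_sum_pi (hf : ∀ i, MemLp (f i) 2 (ν i)) :
    ∫ ω, ∑ i, f i (ω i) ∂(Measure.pi ν) = ∑ i, ∫ x, f i x ∂(ν i) := by
  have hI (i : ι) : Integrable (fun ω : ι → ℝ => f i (ω i)) (Measure.pi ν) :=
    ((hf i).comp_measurePreserving (measurePreserving_eval _ i)).integrable one_le_two
  rw [integral_finsetSum _ fun i _ => hI i]
  refine Finset.sum_congr rfl fun i _ => ?_
  have h := (measurePreserving_eval ν i).map_eq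
  have h2 := integral_map (μ := Measure.pi ν) (measurable_pi_apply i).aemeasurable
    (f := f i) (by simpa only [Function.eval] using h ▸ (hf i).aestronglyMeasurable)
  exact h2.symm.trans (congrArg (fun m => ∫ x, f i x ∂m) h)

/-- Chebyshev's inequality for a sum of functions of the coordinates of a product measure. -/
lemma measureReal_pi_abs_sum_sub_ge (hf : ∀ i, MemLp (f i) 2 (ν i)) {V t : ℝ}
    (hV : ∀ i, Var[f i; ν i] ≤ V) (ht : 0 < t) :
    (Measure.pi ν).real {ω | t ≤ |∑ i, f i (ω i) - ∑ i, ∫ x, f i x ∂(ν i)|} ≤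
      Fintype.card ι * V / t ^ 2 := by
  have hvar : Var[fun ω : ι → ℝ => ∑ i, f i (ω i); Measure.pi ν] ≤ Fintype.card ι * V := by
    have h := variance_sum_pi (μ := ν) hf
    have e : (∑ i, fun ω : ι → ℝ => f i (ω i)) = fun ω : ι → ℝ => ∑ i, f i (ω i) := by
      ext ω; simp
    rw [e] at h
    rw [h]
    calc ∑ i, Var[f i; ν i] ≤ ∑ _i : ι, V := Finset.sum_le_sum fun i _ => hV i
      _ = _ := by simp
  have h := meas_ge_le_variance_div_sq (memLp_sum_pi hf) ht
  rw [integral_sum_pi hf] at h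
  have hnn := variance_nonneg (fun ω : ι → ℝ => ∑ i, f i (ω i)) (Measure.pi ν)
  calc _ ≤ Var[fun ω : ι → ℝ => ∑ i, f i (ω i); Measure.pi ν] / t ^ 2 := by
        refine ENNReal.toReal_le_of_le_ofReal (by positivity) h
    _ ≤ _ := by gcongr

/-- Lower-tail form of Chebyshev's inequality for a product measure. -/
lemma measureReal_pi_sum_lt_le (hf : ∀ i, MemLp (f i) 2 (ν i)) {V t s : ℝ}
    (hV : ∀ i, Var[f i; ν i] ≤ V) (ht : 0 < t) (hs : s + t ≤ ∑ i, ∫ x, f i x ∂(ν i)) :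
    (Measure.pi ν).real {ω | ∑ i, f i (ω i) < s} ≤ Fintype.card ι * V / t ^ 2 := by
  refine (measureReal_mono fun ω hω => ?_).trans (measureReal_pi_abs_sum_sub_ge hf hV ht)
  have hω' : ∑ i, f i (ω i) < s := hω
  change t ≤ |_|
  rw [abs_sub_comm]
  exact le_trans (by linarith) (le_abs_self _)

/-- Upper-tail form of Chebyshev's inequality for a product measure. -/
lemma measureReal_pi_sum_ge_le (hf : ∀ i, MemLp (f i) 2 (ν i)) {V t s : ℝ}
    (hV : ∀ i, Var[f i; ν i] ≤ V) (ht : 0 < t) (hs : (∑ i, ∫ x, f i x ∂(ν i)) + t ≤ s) :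
    (Measure.pi ν).real {ω | s ≤ ∑ i, f i (ω i)} ≤ Fintype.card ι * V / t ^ 2 := by
  refine (measureReal_mono fun ω hω => ?_).trans (measureReal_pi_abs_sum_sub_ge hf hV ht)
  have hω' : s ≤ ∑ i, f i (ω i) := hω
  change t ≤ |_|
  refine le_trans ?_ (le_abs_self _)
  linarith

end ProductMeasure

/-- A unit-norm linear combination of i.i.d. standard Gaussians is standard Gaussian. -/
lemma gaussPi_map_weighted_sum {p : ℕ} {w : Fin p → ℝ} (hw : ∑ j, w j ^ 2 = 1) :
    (gaussPi p).map (fun x => ∑ j, w j * x j) = gaussianReal 0 1 := by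
  have hmem (j : Fin p) : MemLp (fun x : ℝ => w j * x) 2 (gaussianReal 0 1) :=
    (memLp_id_gaussianReal 2).const_mul (w j)
  have hlaw : HasGaussianLaw (fun x : Fin p → ℝ => ∑ j, w j * x j) (gaussPi p) := by
    refine iIndepFun.hasGaussianLaw_fun_sum (X := fun j (x : Fin p → ℝ) => w j * x j) ?_ ?_
    · intro j
      have h0 : HasGaussianLaw (fun x : Fin p → ℝ => x j) (gaussPi p) := by
        constructor
        rw [show (gaussPi p).map (fun x : Fin p → ℝ => x j) = gaussianReal 0 1 from
          (measurePreserving_eval (fun _ : Fin p => gaussianReal 0 1) j).map_eq]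
        infer_instance
      exact h0.smul (w j)
    · exact iIndepFun_pi (X := fun j (x : ℝ) => w j * x) fun j =>
        (measurable_const_mul (w j)).aemeasurable
  rw [hlaw.map_eq_gaussianReal]
  have hmean : ∫ x, ∑ j, w j * x j ∂(gaussPi p) = 0 := by
    unfold gaussPi
    rw [integral_sum_pi (f := fun j x => w j * x) hmem]
    refine Finset.sum_eq_zero fun i _ => ?_
    rw [integral_const_mul, integral_id_gaussianReal, mul_zero]
  have hvar : Var[fun x : Fin p → ℝ => ∑ j, w j * x j; gaussPi p] = 1 := by
    have h := variance_sum_pi (μ := fun _ : Fin p => gaussianReal 0 1)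
      (X := fun j x => w j * x) hmem
    have e : (∑ j, fun x : Fin p → ℝ => w j * x j) = fun x : Fin p → ℝ => ∑ j, w j * x j := by
      ext x; simp
    rw [e] at h
    unfold gaussPi
    rw [h, ← hw]
    refine Finset.sum_congr rfl fun j _ => ?_
    rw [variance_const_mul]
    simp
  rw [hmean, hvar]
  simp

/-- The normalized row sums over a set of columns of the noise matrix are i.i.d. standard
Gaussian. -/
lemma noiseLaw_map_row_sums {n p : ℕ} {T : Finset (Fin p)} (hT : T.Nonempty) :
    (noiseLaw n p).map (fun Z i => (Real.sqrt T.card)⁻¹ * ∑ j ∈ T, Z i j) = gaussPi n := by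
  have hcard : (0 : ℝ) < T.card := by exact_mod_cast hT.card_pos
  have hw : ∑ j : Fin p, (if j ∈ T then (Real.sqrt T.card)⁻¹ else 0) ^ 2 = 1 := by
    simp only [ite_pow, inv_pow, Real.sq_sqrt hcard.le]
    simp [Finset.sum_ite_mem, hcard.ne']
  have hrow := gaussPi_map_weighted_sum hw
  have e : (fun x : Fin p → ℝ => ∑ j, (if j ∈ T then (Real.sqrt T.card)⁻¹ else 0) * x j) =
      fun x => (Real.sqrt T.card)⁻¹ * ∑ j ∈ T, x j := by
    ext x
    simp [Finset.mul_sum, Finset.sum_ite_mem]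
  rw [e] at hrow
  have hm : Measurable fun x : Fin p → ℝ => (Real.sqrt T.card)⁻¹ * ∑ j ∈ T, x j := by fun_prop
  have := Measure.pi_map_pi (μ := fun _ : Fin n => gaussPi p)
    (f := fun _ (x : Fin p → ℝ) => (Real.sqrt T.card)⁻¹ * ∑ j ∈ T, x j)
    (hμ := fun _ => by rw [hrow]; infer_instance) fun _ => hm.aemeasurable
  unfold noiseLaw
  rw [this, hrow]
  rfl

section StandardGaussian

lemma gaussianPDFReal_zero_one (x : ℝ) :
    gaussianPDFReal 0 1 x = (Real.sqrt (2 * Real.pi))⁻¹ * Real.exp (-x ^ 2 / 2) := by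
  simp [gaussianPDFReal]

lemma two_mul_inv_sqrt_two_pi : 2 * (Real.sqrt (2 * Real.pi))⁻¹ = Real.sqrt (2 / Real.pi) := by
  have h2 : Real.sqrt 2 * Real.sqrt 2 = 2 := Real.mul_self_sqrt (by norm_num)
  have hp := Real.sqrt_pos.2 Real.pi_pos
  rw [Real.sqrt_mul (by norm_num), Real.sqrt_div (by norm_num)]
  field_simp
  nlinarith

lemma integral_abs_gaussianReal :
    ∫ x, |x| ∂(gaussianReal 0 1) = Real.sqrt (2 / Real.pi) := by
  rw [integral_gaussianReal_eq_integral_smul one_ne_zero]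
  have e : (fun x : ℝ => gaussianPDFReal 0 1 x • |x|) = fun x =>
      (fun u => (Real.sqrt (2 * Real.pi))⁻¹ *
        (u ^ (1 : ℝ) * Real.exp (-(1 / 2) * u ^ (2 : ℝ)))) |x| := by
    ext x
    simp only [gaussianPDFReal_zero_one, smul_eq_mul, Real.rpow_one, Real.rpow_two, sq_abs]
    rw [show -x ^ 2 / 2 = -(1 / 2) * x ^ 2 by ring]
    ring
  rw [e, integral_comp_abs (f := fun u =>
      (Real.sqrt (2 * Real.pi))⁻¹ * (u ^ (1 : ℝ) * Real.exp (-(1 / 2) * u ^ (2 : ℝ)))),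
    integral_const_mul, integral_rpow_mul_exp_neg_mul_rpow (by norm_num) (by norm_num) (by norm_num),
    ← two_mul_inv_sqrt_two_pi]
  norm_num

lemma measureReal_gaussianReal_le {m a b : ℝ} (hab : a ≤ b) :
    (gaussianReal m 1).real (Set.Ioo a b) ≤ (b - a) * (Real.sqrt (2 * Real.pi))⁻¹ := by
  rw [measureReal_def, gaussianReal_apply_eq_integral _ one_ne_zero,
    ENNReal.toReal_ofReal (integral_nonneg fun x => gaussianPDFReal_nonneg _ _ _)]
  calc ∫ x in Set.Ioo a b, gaussianPDFReal m 1 x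
      ≤ ∫ _x in Set.Ioo a b, (Real.sqrt (2 * Real.pi))⁻¹ := by
        refine integral_mono (integrable_gaussianPDFReal _ _).restrict
          (integrable_const _) fun x => ?_
        simp only [gaussianPDFReal, NNReal.coe_one, mul_one]
        refine mul_le_of_le_one_right (by positivity) ?_
        rw [Real.exp_le_one_iff]
        have := sq_nonneg (x - m)
        linarith
    _ = _ := by simp [hab]

/-- The standard Gaussian density at `1`. -/
noncomputable def phiOne : ℝ := gaussianPDFReal 0 1 1

lemma phiOne_pos : 0 < phiOne := gaussianPDFReal_pos _ _ _ one_ne_zero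

lemma le_measureReal_gaussianReal {s : ℝ} (h0 : 0 ≤ s) (h1 : s ≤ 1) :
    2 * s * phiOne ≤ (gaussianReal 0 1).real (Set.Icc (-s) s) := by
  rw [measureReal_def, gaussianReal_apply_eq_integral _ one_ne_zero,
    ENNReal.toReal_ofReal (integral_nonneg fun x => gaussianPDFReal_nonneg _ _ _)]
  calc 2 * s * phiOne = ∫ _x in Set.Icc (-s) s, phiOne := by
        rw [setIntegral_const, Real.volume_real_Icc_of_le (by linarith), smul_eq_mul]
        ring
    _ ≤ ∫ x in Set.Icc (-s) s, gaussianPDFReal 0 1 x := by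
        refine setIntegral_mono_on (by simp) (integrable_gaussianPDFReal _ _).restrict
          measurableSet_Icc fun x hx => ?_
        simp only [phiOne, gaussianPDFReal_zero_one]
        refine mul_le_mul_of_nonneg_left (Real.exp_le_exp.2 ?_) (by positivity)
        have : |x| ≤ 1 := (abs_le.2 hx).trans h1
        nlinarith [sq_abs x, abs_nonneg x]

lemma memLp_abs_const_add (b : ℝ) : MemLp (fun x : ℝ => |b + x|) 2 (gaussianReal 0 1) :=
  ((memLp_const b).add (memLp_id_gaussianReal 2)).norm

lemma memLp_const_add_sq (b : ℝ) : MemLp (fun x : ℝ => (b + x) ^ 2) 2 (gaussianReal 0 1) := by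
  have h : MemLp (fun x : ℝ => b + x) 4 (gaussianReal 0 1) :=
    (memLp_const b).add (memLp_id_gaussianReal 4)
  have : ENNReal.HolderTriple 4 4 2 := ⟨by
    rw [← two_mul, show (4 : ℝ≥0∞) = 2 * 2 by norm_num, ENNReal.mul_inv (by simp) (by simp),
      ← mul_assoc, ENNReal.mul_inv_cancel (by simp) (by simp), one_mul]⟩
  simpa only [pow_two] using h.mul' h

lemma integral_comp_neg_gaussianReal (f : ℝ → ℝ) :
    ∫ x, f (-x) ∂(gaussianReal 0 1) = ∫ x, f x ∂(gaussianReal 0 1) := by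
  have h : (gaussianReal 0 1).map (fun x : ℝ => -x) = gaussianReal 0 1 := by
    rw [gaussianReal_map_neg, neg_zero]
  conv_rhs => rw [← h]
  exact ((MeasurableEquiv.neg ℝ).measurableEmbedding.integral_map f).symm

/-- Quantitative gain of a mean shift on the first absolute moment of a Gaussian. -/
lemma le_integral_abs_const_add (b : ℝ) :
    Real.sqrt (2 / Real.pi) + phiOne / 2 * (|b| * min |b| 1) ≤
      ∫ x, |b + x| ∂(gaussianReal 0 1) := by
  set s := min |b| 1 / 2 with hs
  have hs0 : 0 ≤ s := by positivity
  have hs1 : s ≤ 1 := by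
    have := min_le_right |b| 1
    linarith
  have hsb : 2 * s ≤ |b| := by
    have := min_le_left |b| 1
    linarith
  have hI (c : ℝ) : Integrable (fun x : ℝ => |c + x|) (gaussianReal 0 1) :=
    (memLp_abs_const_add c).integrable one_le_two
  have hI0 : Integrable (fun x : ℝ => |x|) (gaussianReal 0 1) := by simpa using hI 0
  have hneg : ∫ x, |b + -x| ∂(gaussianReal 0 1) = ∫ x, |b + x| ∂(gaussianReal 0 1) :=
    integral_comp_neg_gaussianReal fun x => |b + x|
  have hIneg : Integrable (fun x : ℝ => |b + -x|) (gaussianReal 0 1) := by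
    have := hI (-b)
    refine this.congr (ae_of_all _ fun x => ?_)
    change |-b + x| = |b + -x|
    rw [← abs_neg]
    congr 1; ring
  have hind : Integrable ((Set.Icc (-s) s).indicator fun _ => |b|) (gaussianReal 0 1) :=
    (integrable_const _).indicator measurableSet_Icc
  have hmono : ∫ x, (2 * |x| + (Set.Icc (-s) s).indicator (fun _ => |b|) x) ∂(gaussianReal 0 1) ≤
      ∫ x, (|b + x| + |b + -x|) ∂(gaussianReal 0 1) := by
    refine integral_mono ((hI0.const_mul 2).add hind) ((hI b).add hIneg) fun x => ?_
    change 2 * |x| + (Set.Icc (-s) s).indicator (fun _ => |b|) x ≤ |b + x| + |b + -x|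
    have t1 : 2 * |x| ≤ |b + x| + |b + -x| := by
      calc 2 * |x| = |(b + x) - (b + -x)| := by
            rw [show (b + x) - (b + -x) = 2 * x by ring, abs_mul]; norm_num
        _ ≤ _ := abs_sub _ _
    have t2 : 2 * |b| ≤ |b + x| + |b + -x| := by
      calc 2 * |b| = |(b + x) + (b + -x)| := by
            rw [show (b + x) + (b + -x) = 2 * b by ring, abs_mul]; norm_num
        _ ≤ _ := abs_add_le _ _
    by_cases hx : x ∈ Set.Icc (-s) s
    · rw [Set.indicator_of_mem hx]
      have := abs_le.2 hx
      linarith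
    · rw [Set.indicator_of_notMem hx]
      linarith
  rw [integral_add (hI0.const_mul 2) hind, integral_add (hI b) hIneg, hneg, integral_const_mul,
    integral_abs_gaussianReal, integral_indicator measurableSet_Icc] at hmono
  simp only [integral_const, MeasurableSet.univ, measureReal_restrict_apply, Set.univ_inter,
    smul_eq_mul] at hmono
  have hG := mul_le_mul_of_nonneg_right (le_measureReal_gaussianReal hs0 hs1) (abs_nonneg b)
  have e : phiOne / 2 * (|b| * min |b| 1) = 2 * s * phiOne * |b| / 2 := by
    rw [hs]; ring
  rw [e]
  linarith

lemma variance_abs_const_add_le (b : ℝ) :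
    Var[fun x : ℝ => |b + x|; gaussianReal 0 1] ≤ 1 := by
  have h1 : MemLp (fun x : ℝ => b + x) 2 (gaussianReal 0 1) :=
    (memLp_const b).add (memLp_id_gaussianReal 2)
  have hv : Var[fun x : ℝ => b + x; gaussianReal 0 1] = 1 := by
    rw [variance_const_add (by fun_prop)]
    simp
  rw [variance_eq_sub (memLp_abs_const_add b), ← hv, variance_eq_sub h1]
  have e : ((fun x : ℝ => |b + x|) ^ 2) = (fun x : ℝ => b + x) ^ 2 := by
    ext x; simp
  rw [e]
  have := sq_le_sq.2 ((abs_integral_le_integral_abs (f := fun x : ℝ => b + x)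
    (μ := gaussianReal 0 1)).trans (le_abs_self _))
  linarith

lemma integral_sq_gaussianReal : ∫ x, x ^ 2 ∂(gaussianReal 0 1) = 1 := by
  have h := variance_eq_sub (memLp_id_gaussianReal (μ := 0) (v := 1) 2)
  simpa using h.symm

lemma integral_const_add_sq (b : ℝ) : ∫ x, (b + x) ^ 2 ∂(gaussianReal 0 1) = b ^ 2 + 1 := by
  have h2 : Integrable (fun x : ℝ => x ^ 2) (gaussianReal 0 1) := by
    simpa using (memLp_const_add_sq 0).integrable one_le_two
  have h1 : Integrable (fun x : ℝ => x) (gaussianReal 0 1) :=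
    (memLp_id_gaussianReal 1).integrable le_rfl
  have e (x : ℝ) : (b + x) ^ 2 = b ^ 2 + (2 * b * x + x ^ 2) := by ring
  have h12 : Integrable (fun x : ℝ => 2 * b * x + x ^ 2) (gaussianReal 0 1) :=
    (h1.const_mul _).add h2
  simp_rw [e]
  rw [integral_add (integrable_const _) h12, integral_add (h1.const_mul _) h2,
    integral_const_mul, integral_sq_gaussianReal,
    integral_id_gaussianReal]
  simp

/-- Fourth moment of the standard Gaussian. -/
noncomputable def fourthMoment : ℝ := ∫ x, (x ^ 2) ^ 2 ∂(gaussianReal 0 1)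

lemma fourthMoment_nonneg : 0 ≤ fourthMoment := integral_nonneg fun x => by positivity

lemma variance_const_add_sq_le (b : ℝ) :
    Var[fun x : ℝ => (b + x) ^ 2; gaussianReal 0 1] ≤ 8 * b ^ 2 + 2 * fourthMoment := by
  have h2' : MemLp (fun x : ℝ => x ^ 2) 2 (gaussianReal 0 1) := by
    simpa using memLp_const_add_sq 0
  have h2 : Integrable (fun x : ℝ => x ^ 2) (gaussianReal 0 1) := h2'.integrable one_le_two
  have h4 : Integrable (fun x : ℝ => (x ^ 2) ^ 2) (gaussianReal 0 1) := h2'.integrable_sq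
  have e : (fun x : ℝ => (b + x) ^ 2) = fun x => b ^ 2 + (2 * b * x + x ^ 2) := by
    ext x; ring
  have hm : MemLp (fun x : ℝ => 2 * b * x + x ^ 2) 2 (gaussianReal 0 1) :=
    ((memLp_id_gaussianReal 2).const_mul (2 * b)).add h2'
  rw [e, variance_const_add (by fun_prop)]
  refine (variance_le_expectation_sq (by fun_prop)).trans ?_
  calc ∫ x, ((fun x : ℝ => 2 * b * x + x ^ 2) ^ 2) x ∂(gaussianReal 0 1)
      ≤ ∫ x, (8 * b ^ 2 * x ^ 2 + 2 * (x ^ 2) ^ 2) ∂(gaussianReal 0 1) := by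
        refine integral_mono hm.integrable_sq ((h2.const_mul _).add (h4.const_mul _)) fun x => ?_
        change (2 * b * x + x ^ 2) ^ 2 ≤ 8 * b ^ 2 * x ^ 2 + 2 * (x ^ 2) ^ 2
        nlinarith [sq_nonneg (2 * b * x - x ^ 2)]
    _ = _ := by
        rw [integral_add (h2.const_mul _) (h4.const_mul _), integral_const_mul,
          integral_const_mul, integral_sq_gaussianReal]
        simp [fourthMoment]

lemma integrable_exp_mul_abs (t : ℝ) :
    Integrable (fun x : ℝ => Real.exp (t * |x|)) (gaussianReal 0 1) := by
  refine Integrable.mono' ((integrable_exp_mul_gaussianReal t).add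
    (integrable_exp_mul_gaussianReal (-t))) (by fun_prop) (ae_of_all _ fun x => ?_)
  rw [Real.norm_of_nonneg (Real.exp_pos _).le]
  change _ ≤ Real.exp (t * x) + Real.exp (-t * x)
  rcases abs_cases x with ⟨h, _⟩ | ⟨h, _⟩ <;> rw [h]
  · linarith [Real.exp_pos (-t * x)]
  · rw [show t * -x = -t * x by ring]
    linarith [Real.exp_pos (t * x)]

lemma integral_exp_mul_abs_le {t : ℝ} (ht : 0 ≤ t) :
    ∫ x, Real.exp (t * |x|) ∂(gaussianReal 0 1) ≤
      Real.exp (t * Real.sqrt (2 / Real.pi) + t ^ 2 / 2) := by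
  have hmap : (gaussianReal t 1).real (Set.Ioi 0) = (gaussianReal 0 1).real (Set.Ioi (-t)) := by
    have h := gaussianReal_map_add_const (μ := 0) (v := 1) t
    rw [zero_add] at h
    rw [← h, map_measureReal_apply (by fun_prop) measurableSet_Ioi]
    congr 1
    ext x
    simp [neg_lt_iff_pos_add]
  have hsymm : (gaussianReal 0 1).real (Set.Iio t) = (gaussianReal 0 1).real (Set.Ioi (-t)) := by
    have h := gaussianReal_map_neg (μ := 0) (v := 1)
    rw [neg_zero] at h
    conv_lhs => rw [← h, map_measureReal_apply (by fun_prop) measurableSet_Iio]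
    congr 1
    ext x
    simp
  have htwo : 2 * (gaussianReal t 1).real (Set.Ioi 0) ≤ 1 + t * Real.sqrt (2 / Real.pi) := by
    have h := measureReal_union_add_inter (μ := gaussianReal 0 1) (s := Set.Ioi (-t))
      (t := Set.Iio t) measurableSet_Iio
    have h1 : (gaussianReal 0 1).real (Set.Ioi (-t) ∪ Set.Iio t) ≤ 1 := measureReal_le_one
    have h2 : (gaussianReal 0 1).real (Set.Ioi (-t) ∩ Set.Iio t) ≤ _ :=
      measureReal_gaussianReal_le (m := 0) (show -t ≤ t by linarith)
    rw [← two_mul_inv_sqrt_two_pi, hmap]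
    rw [hsymm] at h
    linarith
  have hval : ∫ x, Real.exp (t * |x|) ∂(gaussianReal 0 1) =
      Real.exp (t ^ 2 / 2) * (2 * (gaussianReal t 1).real (Set.Ioi 0)) := by
    rw [integral_gaussianReal_eq_integral_smul one_ne_zero]
    have e : (fun x : ℝ => gaussianPDFReal 0 1 x • Real.exp (t * |x|)) = fun x =>
        (fun u => Real.exp (t ^ 2 / 2) * gaussianPDFReal t 1 u) |x| := by
      ext x
      simp only [gaussianPDFReal, smul_eq_mul, NNReal.coe_one, mul_one, sub_zero]
      rw [mul_left_comm, mul_assoc, ← Real.exp_add, ← Real.exp_add]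
      congr 2
      rw [← sq_abs x]
      ring
    rw [e, integral_comp_abs (f := fun u => Real.exp (t ^ 2 / 2) * gaussianPDFReal t 1 u),
      integral_const_mul, measureReal_def,
      gaussianReal_apply_eq_integral _ one_ne_zero,
      ENNReal.toReal_ofReal (integral_nonneg fun x => gaussianPDFReal_nonneg _ _ _)]
    ring
  rw [hval, Real.exp_add, mul_comm]
  refine mul_le_mul_of_nonneg_right (htwo.trans ?_) (Real.exp_pos _).le
  linarith [Real.add_one_le_exp (t * Real.sqrt (2 / Real.pi))]

end StandardGaussian

/-- Chernoff bound for the `ℓ¹`-norm of a standard Gaussian vector. -/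
lemma measureReal_gaussPi_sum_abs_ge_le {n : ℕ} (hn : 0 < n) {s : ℝ} (hs : 0 ≤ s) :
    (gaussPi n).real {w | Real.sqrt (2 / Real.pi) * n + s ≤ ∑ i, |w i|} ≤
      Real.exp (-(s ^ 2 / (2 * n))) := by
  have hn' : (0 : ℝ) < n := by exact_mod_cast hn
  set t := s / n with ht
  have ht0 : 0 ≤ t := by positivity
  have e : (fun w : Fin n → ℝ => Real.exp (t * ∑ i, |w i|)) =
      fun w => ∏ i, Real.exp (t * |w i|) := by
    ext w
    rw [Finset.mul_sum, Real.exp_sum]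
  have hint : Integrable (fun w : Fin n → ℝ => Real.exp (t * ∑ i, |w i|)) (gaussPi n) := by
    rw [e]
    exact Integrable.fintype_prod (f := fun _ x => Real.exp (t * |x|))
      fun _ => integrable_exp_mul_abs t
  have hmgf : mgf (fun w : Fin n → ℝ => ∑ i, |w i|) (gaussPi n) t ≤
      Real.exp (n * (t * Real.sqrt (2 / Real.pi) + t ^ 2 / 2)) := by
    unfold mgf gaussPi
    rw [e, integral_fintype_prod_eq_prod (f := fun _ x => Real.exp (t * |x|)),
      Finset.prod_const, Finset.card_univ, Fintype.card_fin, Real.exp_nat_mul]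
    exact pow_le_pow_left₀ (integral_nonneg fun x => (Real.exp_pos _).le)
      (integral_exp_mul_abs_le ht0) n
  refine (measure_ge_le_exp_mul_mgf _ ht0 hint).trans ?_
  refine (mul_le_mul_of_nonneg_left hmgf (Real.exp_pos _).le).trans ?_
  rw [← Real.exp_add, Real.exp_le_exp, ht]
  apply le_of_eq
  field_simp
  ring

lemma ae_pi_signLaw (n : ℕ) :
    ∀ᵐ ℓ ∂(Measure.pi fun _ : Fin n => signLaw), ∀ i, ℓ i = 1 ∨ ℓ i = -1 := by
  have h : ∀ᵐ x ∂signLaw, x = 1 ∨ x = -1 := by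
    unfold signLaw
    rw [ae_add_measure_iff]
    exact ⟨Measure.ae_smul_measure (by simp [ae_dirac_eq]) _,
      Measure.ae_smul_measure (by simp [ae_dirac_eq]) _⟩
  exact ae_all_iff.2 fun i =>
    (measurePreserving_eval (fun _ : Fin n => signLaw) i).quasiMeasurePreserving.ae h

section MuLaw

variable {p : ℕ} {ε τ : ℝ}

lemma ae_muLaw : ∀ᵐ x ∂(muLaw ε τ), x = 0 ∨ x = τ := by
  unfold muLaw
  rw [ae_add_measure_iff]
  exact ⟨Measure.ae_smul_measure (by simp [ae_dirac_eq]) _,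
    Measure.ae_smul_measure (by simp [ae_dirac_eq]) _⟩

lemma ae_pi_muLaw (h0 : 0 ≤ ε) (h1 : ε ≤ 1) :
    ∀ᵐ μ ∂(Measure.pi fun _ : Fin p => muLaw ε τ), ∀ j, μ j = 0 ∨ μ j = τ := by
  have := isProbabilityMeasure_muLaw (τ := τ) h0 h1
  exact ae_all_iff.2 fun i =>
    (measurePreserving_eval (fun _ : Fin p => muLaw ε τ) i).quasiMeasurePreserving.ae ae_muLaw

lemma integral_muLaw (h0 : 0 ≤ ε) (h1 : ε ≤ 1) (f : ℝ → ℝ) :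
    ∫ x, f x ∂(muLaw ε τ) = (1 - ε) * f 0 + ε * f τ := by
  unfold muLaw
  rw [integral_add_measure ((integrable_dirac (by simp)).smul_measure (by simp))
    ((integrable_dirac (by simp)).smul_measure (by simp)), integral_smul_measure,
    integral_smul_measure, integral_dirac, integral_dirac,
    ENNReal.toReal_ofReal h0, ENNReal.toReal_ofReal (by linarith)]
  rfl

lemma memLp_id_muLaw (h0 : 0 ≤ ε) (h1 : ε ≤ 1) : MemLp (fun x : ℝ => x) 2 (muLaw ε τ) := by
  have := isProbabilityMeasure_muLaw (τ := τ) h0 h1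
  refine MemLp.of_bound (by fun_prop) |τ| (ae_muLaw.mono fun x hx => ?_)
  rcases hx with rfl | rfl <;> simp

lemma variance_id_muLaw_le (h0 : 0 ≤ ε) (h1 : ε ≤ 1) :
    Var[fun x : ℝ => x; muLaw ε τ] ≤ ε * τ ^ 2 := by
  have := isProbabilityMeasure_muLaw (τ := τ) h0 h1
  refine (variance_le_expectation_sq (by fun_prop)).trans (le_of_eq ?_)
  rw [integral_muLaw h0 h1]
  simp

/-- The configurations of the mean vector for which the signal is at least half its
expectation. -/
def strongSignal (p : ℕ) (ε τ : ℝ) : Set (Fin p → ℝ) :=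
  {μ | (∀ j, μ j = 0 ∨ μ j = τ) ∧ p * (ε * τ) / 2 ≤ ∑ j, μ j}

lemma measurableSet_strongSignal : MeasurableSet (strongSignal p ε τ) := by
  unfold strongSignal
  measurability

lemma measureReal_compl_strongSignal_le (hp : 0 < p) (h0 : 0 < ε) (h1 : ε ≤ 1) (hτ : 0 < τ) :
    (Measure.pi fun _ : Fin p => muLaw ε τ).real (strongSignal p ε τ)ᶜ ≤ 4 / (p * ε) := by
  have hpr := isProbabilityMeasure_muLaw (τ := τ) h0.le h1
  have hp' : (0 : ℝ) < p := by exact_mod_cast hp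
  have hle : (strongSignal p ε τ)ᶜ ≤ᵐ[Measure.pi fun _ : Fin p => muLaw ε τ]
      {μ | ∑ j, μ j < p * (ε * τ) / 2} := by
    filter_upwards [ae_pi_muLaw h0.le h1] with μ hμ hμS
    by_contra hlt
    exact hμS ⟨hμ, not_lt.1 hlt⟩
  have hcheb := measureReal_pi_sum_lt_le (ν := fun _ : Fin p => muLaw ε τ)
    (f := fun _ x => x) (fun _ => memLp_id_muLaw h0.le h1)
    (fun _ => variance_id_muLaw_le h0.le h1)
    (t := p * (ε * τ) / 2) (s := p * (ε * τ) / 2) (by positivity)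
    (by rw [integral_muLaw h0.le h1]; simp)
  refine (ENNReal.toReal_mono (measure_ne_top _ _) (measure_mono_ae hle)).trans
    (hcheb.trans (le_of_eq ?_))
  rw [Fintype.card_fin]
  field_simp
  norm_num

/-- Type II error probabilities are controlled by conditioning on labels and on a strong
signal. -/
lemma jointLaw_real_le {n : ℕ} (hp : 0 < p) (h0 : 0 < ε) (h1 : ε ≤ 1) (hτ : 0 < τ)
    {A : Set (Omega n p)} (hA : MeasurableSet A) {δ : ℝ} (hδ : 0 ≤ δ)
    (h : ∀ ℓ : Fin n → ℝ, (∀ i, ℓ i = 1 ∨ ℓ i = -1) → ∀ μ ∈ strongSignal p ε τ,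
      (noiseLaw n p).real {Z | (ℓ, μ, Z) ∈ A} ≤ δ) :
    (jointLaw n p ε τ).real A ≤ 4 / (p * ε) + δ := by
  have hpr := isProbabilityMeasure_muLaw (τ := τ) h0.le h1
  have hsec (ℓ : Fin n → ℝ) (hℓ : ∀ i, ℓ i = 1 ∨ ℓ i = -1) :
      ((Measure.pi fun _ : Fin p => muLaw ε τ).prod (noiseLaw n p)) (Prod.mk ℓ ⁻¹' A) ≤
        ENNReal.ofReal (4 / (p * ε)) + ENNReal.ofReal δ := by
    rw [Measure.prod_apply (measurable_prodMk_left hA)]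
    calc ∫⁻ μ, noiseLaw n p (Prod.mk μ ⁻¹' (Prod.mk ℓ ⁻¹' A))
          ∂(Measure.pi fun _ : Fin p => muLaw ε τ)
        ≤ ∫⁻ μ, ((strongSignal p ε τ)ᶜ.indicator 1 μ + ENNReal.ofReal δ)
          ∂(Measure.pi fun _ : Fin p => muLaw ε τ) := by
          refine lintegral_mono fun μ => ?_
          by_cases hμ : μ ∈ strongSignal p ε τ
          · refine le_add_left ?_
            rw [← ofReal_measureReal]
            exact ENNReal.ofReal_le_ofReal (h ℓ hℓ μ hμ)
          · rw [Set.indicator_of_mem (Set.mem_compl hμ)]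
            exact le_add_right prob_le_one
      _ ≤ _ := by
          rw [lintegral_add_right _ measurable_const,
            lintegral_indicator_one measurableSet_strongSignal.compl]
          simp only [lintegral_const, measure_univ, mul_one]
          refine add_le_add_left ?_ _
          rw [← ofReal_measureReal]
          exact ENNReal.ofReal_le_ofReal (measureReal_compl_strongSignal_le hp h0 h1 hτ)
  have hmain : jointLaw n p ε τ A ≤ ENNReal.ofReal (4 / (p * ε)) + ENNReal.ofReal δ := by
    unfold jointLaw
    rw [Measure.prod_apply hA]
    refine (lintegral_mono_ae ((ae_pi_signLaw n).mono hsec)).trans ?_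
    simp
  have hpos : 0 ≤ 4 / (p * ε) := by positivity
  rw [← ENNReal.ofReal_add hpos hδ] at hmain
  exact ENNReal.toReal_le_of_le_ofReal (by positivity) hmain

end MuLaw

section RowSums

variable {n p : ℕ}

lemma noiseLaw_real_row_sums {T : Finset (Fin p)} (hT : T.Nonempty) {B : Set (Fin n → ℝ)}
    (hB : MeasurableSet B) (ℓ : Fin n → ℝ) (μ : Fin p → ℝ) :
    (noiseLaw n p).real
        {Z | (fun i => (Real.sqrt T.card)⁻¹ * ∑ j ∈ T, dataMap (ℓ, μ, Z) i j) ∈ B} =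
      (gaussPi n).real
        {w | (fun i => ℓ i * ((Real.sqrt T.card)⁻¹ * ∑ j ∈ T, μ j) + w i) ∈ B} := by
  rw [← noiseLaw_map_row_sums hT, map_measureReal_apply (by fun_prop)]
  · congr 1
    ext Z
    simp only [dataMap, Set.mem_ofPred_eq, Set.mem_preimage, Finset.sum_add_distrib,
      ← Finset.mul_sum, mul_add]
    simp only [mul_left_comm]
  · exact (show Measurable fun (w : Fin n → ℝ) i =>
      ℓ i * ((Real.sqrt T.card)⁻¹ * ∑ j ∈ T, μ j) + w i by fun_prop) hB

lemma noiseLaw_real_row_sums_null {T : Finset (Fin p)} (hT : T.Nonempty) {B : Set (Fin n → ℝ)}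
    (hB : MeasurableSet B) :
    (noiseLaw n p).real {Z | (fun i => (Real.sqrt T.card)⁻¹ * ∑ j ∈ T, Z i j) ∈ B} =
      (gaussPi n).real B := by
  rw [← noiseLaw_map_row_sums hT, map_measureReal_apply (by fun_prop) hB]
  rfl

lemma measurable_dataMap : Measurable (dataMap : Omega n p → Fin n → Fin p → ℝ) := by
  unfold dataMap
  fun_prop

end RowSums

section SimpleAggregation

variable {n p : ℕ}

lemma mem_rejSA_iff (hn : 0 < n) (hp : 0 < p) {X : Fin n → Fin p → ℝ} :
    X ∈ rejSA ↔ n + Real.sqrt (2 * n) * (2 * Real.sqrt (2 * Real.log p)) ≤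
      ∑ i, ((Real.sqrt (Finset.univ : Finset (Fin p)).card)⁻¹ * ∑ j, X i j) ^ 2 := by
  have hn' : (0 : ℝ) < n := by exact_mod_cast hn
  have hp' : (0 : ℝ) < p := by exact_mod_cast hp
  have e : (p : ℝ) * ∑ i, ((p : ℝ)⁻¹ * ∑ j, X i j) ^ 2 =
      ∑ i, ((Real.sqrt (Finset.univ : Finset (Fin p)).card)⁻¹ * ∑ j, X i j) ^ 2 := by
    rw [Finset.mul_sum]
    refine Finset.sum_congr rfl fun i _ => ?_
    rw [Finset.card_univ, Fintype.card_fin, mul_pow, mul_pow, inv_pow, inv_pow,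
      Real.sq_sqrt hp'.le]
    field_simp
  change 2 * Real.sqrt (2 * Real.log p) ≤ _ ↔ _
  rw [e, le_div_iff₀ (by positivity), le_sub_iff_add_le, mul_comm, add_comm]

lemma measurableSet_rejSA : MeasurableSet (rejSA : Set (Fin n → Fin p → ℝ)) := by
  unfold rejSA
  exact measurableSet_le measurable_const (by fun_prop)

lemma noiseLaw_rejSA_le (hn : 0 < n) (hp : 1 < p) :
    (noiseLaw n p).real rejSA ≤ fourthMoment / (8 * Real.log p) := by
  have hn' : (0 : ℝ) < n := by exact_mod_cast hn
  have hL : 0 < Real.log p := Real.log_pos (by exact_mod_cast hp)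
  have : NeZero p := ⟨by omega⟩
  set t := Real.sqrt (2 * n) * (2 * Real.sqrt (2 * Real.log p)) with ht
  have ht2 : t ^ 2 = 16 * n * Real.log p := by
    rw [ht, mul_pow, mul_pow, Real.sq_sqrt (by positivity), Real.sq_sqrt (by positivity)]
    ring
  have e : (rejSA : Set (Fin n → Fin p → ℝ)) =
      {Z | (fun i => (Real.sqrt (Finset.univ : Finset (Fin p)).card)⁻¹ *
        ∑ j ∈ (Finset.univ : Finset (Fin p)), Z i j) ∈
          {w : Fin n → ℝ | n + t ≤ ∑ i, w i ^ 2}} := by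
    ext X
    exact mem_rejSA_iff hn (by omega)
  rw [e, noiseLaw_real_row_sums_null Finset.univ_nonempty
    (measurableSet_le measurable_const (by fun_prop))]
  have hcheb := measureReal_pi_sum_ge_le (ν := fun _ : Fin n => gaussianReal 0 1)
    (f := fun _ x => x ^ 2) (fun _ => by simpa using memLp_const_add_sq 0)
    (V := 2 * fourthMoment) (fun _ => by simpa using variance_const_add_sq_le 0)
    (t := t) (s := n + t) (by positivity) (by simp [integral_sq_gaussianReal])
  refine hcheb.trans (le_of_eq ?_)
  rw [ht2, Fintype.card_fin]
  field_simp
  ring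

lemma jointLaw_compl_rejSA_le {ε τ D : ℝ} (hn : 0 < n) (hp : 1 < p) (hε0 : 0 < ε)
    (hε1 : ε ≤ 1) (hτ : 0 < τ) (hD0 : 1 ≤ D) (hD1 : 8 * Real.sqrt (Real.log p) ≤ D)
    (hD2 : D ≤ Real.sqrt n * (p * ε ^ 2 * τ ^ 2 / 4)) :
    (jointLaw n p ε τ).real {ω | dataMap ω ∉ rejSA} ≤
      4 / (p * ε) + (32 + 8 * fourthMoment) / D := by
  have hK := fourthMoment_nonneg
  have hn' : (1 : ℝ) ≤ n := by exact_mod_cast hn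
  have hp' : (0 : ℝ) < p := by exact_mod_cast (by omega : 0 < p)
  have : NeZero p := ⟨by omega⟩
  refine jointLaw_real_le (by omega) hε0 hε1 hτ (measurable_dataMap measurableSet_rejSA.compl)
    (by positivity) fun ℓ hℓ μ hμ => ?_
  set t := Real.sqrt (2 * n) * (2 * Real.sqrt (2 * Real.log p)) with ht
  have ht' : t = 4 * (Real.sqrt n * Real.sqrt (Real.log p)) := by
    rw [ht, Real.sqrt_mul (by norm_num), Real.sqrt_mul (by norm_num)]
    linear_combination (2 * Real.sqrt n * Real.sqrt (Real.log p)) *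
      Real.mul_self_sqrt (show (0 : ℝ) ≤ 2 by norm_num)
  set b := (Real.sqrt (Finset.univ : Finset (Fin p)).card)⁻¹ * ∑ j, μ j with hb
  have hbD : D ≤ Real.sqrt n * b ^ 2 := by
    refine hD2.trans (mul_le_mul_of_nonneg_left ?_ (Real.sqrt_nonneg _))
    have hsq := pow_le_pow_left₀ (by positivity) hμ.2 2
    rw [hb, mul_pow, inv_pow, Finset.card_univ, Fintype.card_fin, Real.sq_sqrt hp'.le,
      inv_mul_eq_div, le_div_iff₀ hp']
    refine le_trans (le_of_eq ?_) hsq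
    ring
  have e : {Z : Fin n → Fin p → ℝ | (ℓ, μ, Z) ∈ (dataMap : Omega n p → _) ⁻¹' rejSAᶜ} =
      {Z | (fun i => (Real.sqrt (Finset.univ : Finset (Fin p)).card)⁻¹ *
        ∑ j ∈ (Finset.univ : Finset (Fin p)), dataMap (ℓ, μ, Z) i j) ∈
          {w : Fin n → ℝ | ∑ i, w i ^ 2 < n + t}} := by
    ext Z
    exact (mem_rejSA_iff hn (by omega)).not.trans not_le
  rw [e, noiseLaw_real_row_sums Finset.univ_nonempty
    (measurableSet_lt (by fun_prop) measurable_const), ← hb]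
  have hsqrt : 1 ≤ Real.sqrt n := Real.one_le_sqrt.2 hn'
  have hsn : Real.sqrt n * Real.sqrt n = n := Real.mul_self_sqrt (by positivity)
  have hb0 : 0 < b ^ 2 := by
    by_contra hcon
    have : b ^ 2 = 0 := le_antisymm (not_lt.1 hcon) (sq_nonneg b)
    rw [this] at hbD
    linarith
  have hℓ2 (i : Fin n) : (ℓ i * b) ^ 2 = b ^ 2 := by
    rcases hℓ i with h | h <;> rw [h] <;> ring
  have hcheb := measureReal_pi_sum_lt_le (ν := fun _ : Fin n => gaussianReal 0 1)
    (f := fun i x => (ℓ i * b + x) ^ 2) (fun i => memLp_const_add_sq _)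
    (V := 8 * b ^ 2 + 2 * fourthMoment)
    (fun i => (variance_const_add_sq_le _).trans (by rw [hℓ2]))
    (t := n * b ^ 2 / 2) (s := n + t) (by positivity) (by
      simp only [integral_const_add_sq, hℓ2, Finset.sum_const, Finset.card_univ,
        Fintype.card_fin, nsmul_eq_mul]
      have h1 : 8 * Real.sqrt (Real.log p) ≤ Real.sqrt n * b ^ 2 := hD1.trans hbD
      have h2 := mul_le_mul_of_nonneg_left h1 (Real.sqrt_nonneg n)
      rw [ht']
      nlinarith)
  refine hcheb.trans ?_
  rw [Fintype.card_fin]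
  have hD : 0 < D := by linarith
  have h1 : D ≤ n * b ^ 2 := by
    rw [← hsn, mul_assoc]
    nlinarith
  have h2 : D ≤ n * (b ^ 2) ^ 2 := by
    have := mul_le_mul hbD hbD hD.le (by positivity)
    have e2 : Real.sqrt n * b ^ 2 * (Real.sqrt n * b ^ 2) = n * (b ^ 2) ^ 2 := by
      linear_combination (b ^ 2 * b ^ 2) * hsn
    rw [e2] at this
    nlinarith
  calc (n : ℝ) * (8 * b ^ 2 + 2 * fourthMoment) / (n * b ^ 2 / 2) ^ 2
      = 32 / (n * b ^ 2) + 8 * fourthMoment / (n * (b ^ 2) ^ 2) := by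
        field_simp
        ring
    _ ≤ 32 / D + 8 * fourthMoment / D := by gcongr
    _ = _ := by ring

end SimpleAggregation

section SparseAggregation

variable {n p N : ℕ} {S : (Fin n → Fin p → ℝ) → Finset (Fin p)}

lemma inv_sqrt_mul_sum_abs (T : Finset (Fin p)) (X : Fin n → Fin p → ℝ) :
    (Real.sqrt T.card)⁻¹ * ∑ i, |∑ j ∈ T, X i j| =
      ∑ i, |(Real.sqrt T.card)⁻¹ * ∑ j ∈ T, X i j| := by
  rw [Finset.mul_sum]
  refine Finset.sum_congr rfl fun i _ => ?_
  rw [abs_mul, abs_of_nonneg (inv_nonneg.2 (Real.sqrt_nonneg _))]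

lemma mem_rejSparse_iff (hS : IsSparseAggMaximizer N S) {X : Fin n → Fin p → ℝ} :
    X ∈ rejSparse N S ↔ ∃ T : Finset (Fin p), T.card = N ∧
      Real.sqrt (2 / Real.pi) * n + Real.sqrt (2 * n * (N + 2) * Real.log p) ≤
        ∑ i, |(Real.sqrt T.card)⁻¹ * ∑ j ∈ T, X i j| := by
  simp_rw [← inv_sqrt_mul_sum_abs]
  constructor
  · intro hX
    refine ⟨S X, (hS X).1, ?_⟩
    rw [(hS X).1]
    exact hX
  · rintro ⟨T, hT, hX⟩
    rw [hT] at hX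
    exact hX.trans (mul_le_mul_of_nonneg_left ((hS X).2 T hT)
      (inv_nonneg.2 (Real.sqrt_nonneg _)))

lemma rejSparse_eq_iUnion (hS : IsSparseAggMaximizer N S) :
    rejSparse N S = ⋃ T ∈ Finset.powersetCard N (Finset.univ : Finset (Fin p)),
      {X | (fun i => (Real.sqrt T.card)⁻¹ * ∑ j ∈ T, X i j) ∈ {w : Fin n → ℝ |
        Real.sqrt (2 / Real.pi) * n + Real.sqrt (2 * n * (N + 2) * Real.log p) ≤
          ∑ i, |w i|}} := by
  ext X
  simp [mem_rejSparse_iff hS]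

lemma measurableSet_rejSparse (hS : IsSparseAggMaximizer N S) :
    MeasurableSet (rejSparse N S) := by
  rw [rejSparse_eq_iUnion hS]
  refine Finset.measurableSet_biUnion _ fun T _ => ?_
  have hm : Measurable fun X : Fin n → Fin p → ℝ =>
      ∑ i, |(Real.sqrt T.card)⁻¹ * ∑ j ∈ T, X i j| := by fun_prop
  exact measurableSet_le measurable_const hm

lemma noiseLaw_rejSparse_le (hS : IsSparseAggMaximizer N S) (hn : 0 < n) (hN : 0 < N)
    (hp : 0 < p) : (noiseLaw n p).real (rejSparse N S) ≤ ((p : ℝ) ^ 2)⁻¹ := by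
  have hn' : (0 : ℝ) < n := by exact_mod_cast hn
  have hp' : (0 : ℝ) < p := by exact_mod_cast hp
  have hL : 0 ≤ Real.log p := Real.log_natCast_nonneg p
  have hexp : Real.exp (-(Real.sqrt (2 * n * (N + 2) * Real.log p) ^ 2 / (2 * n))) =
      ((p : ℝ) ^ (N + 2))⁻¹ := by
    rw [Real.sq_sqrt (by positivity), Real.exp_neg]
    congr 1
    rw [show 2 * n * (N + 2) * Real.log p / (2 * n) = ((N + 2 : ℕ) : ℝ) * Real.log p by
      push_cast; field_simp, Real.exp_nat_mul, Real.exp_log hp']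
  rw [rejSparse_eq_iUnion hS]
  refine (measureReal_biUnion_finset_le _ _).trans ?_
  calc _ ≤ ∑ _T ∈ Finset.powersetCard N (Finset.univ : Finset (Fin p)),
        ((p : ℝ) ^ (N + 2))⁻¹ := by
        refine Finset.sum_le_sum fun T hT => ?_
        have hTc : T.card = N := (Finset.mem_powersetCard.1 hT).2
        rw [noiseLaw_real_row_sums_null (Finset.card_pos.1 (hTc ▸ hN))
          (measurableSet_le measurable_const (by fun_prop)), ← hexp]
        exact measureReal_gaussPi_sum_abs_ge_le hn (Real.sqrt_nonneg _)
    _ = (p.choose N : ℝ) * ((p : ℝ) ^ (N + 2))⁻¹ := by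
        rw [Finset.sum_const, Finset.card_powersetCard, Finset.card_univ, Fintype.card_fin,
          nsmul_eq_mul]
    _ ≤ (p : ℝ) ^ N * ((p : ℝ) ^ (N + 2))⁻¹ := by
        gcongr
        exact_mod_cast Nat.choose_le_pow p N
    _ = _ := by
        rw [pow_add]
        field_simp

/-- A strong signal is captured in part by some set of columns of prescribed size. -/
lemma exists_card_eq_le_sum {ε τ : ℝ} {μ : Fin p → ℝ} (hμ : μ ∈ strongSignal p ε τ)
    (hτ : 0 < τ) (hN : N ≤ p) (hNε : N ≤ 2 * (p * ε)) :
    ∃ T : Finset (Fin p), T.card = N ∧ N * τ / 4 ≤ ∑ j ∈ T, μ j := by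
  set s := suppSet μ with hs
  have hval (j : Fin p) (hj : j ∈ s) : μ j = τ :=
    (hμ.1 j).resolve_left (Finset.mem_filter.1 hj).2
  have hnn (j : Fin p) : 0 ≤ μ j := by
    rcases hμ.1 j with h | h <;> rw [h]
    exact hτ.le
  have hsum (t : Finset (Fin p)) (ht : t ⊆ s) : ∑ j ∈ t, μ j = t.card * τ := by
    rw [Finset.sum_congr rfl fun j hj => hval j (ht hj), Finset.sum_const, nsmul_eq_mul]
  have htot : ∑ j, μ j = s.card * τ := by
    rw [← hsum s subset_rfl]
    exact (Finset.sum_subset (Finset.subset_univ s) fun j _ hj => by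
      simpa [hs, suppSet] using hj).symm
  have hcard : (N : ℝ) * τ / 4 ≤ s.card * τ := by
    rw [← htot]
    refine le_trans ?_ hμ.2
    nlinarith
  rcases le_total N s.card with h | h
  · obtain ⟨T, hTs, hT⟩ := Finset.exists_subset_card_eq h
    refine ⟨T, hT, ?_⟩
    rw [hsum T hTs, hT]
    have : 0 ≤ (N : ℝ) * τ := by positivity
    linarith
  · obtain ⟨T, hsT, hT⟩ := Finset.exists_superset_card_eq h (by simpa using hN)
    refine ⟨T, hT, hcard.trans ?_⟩
    rw [← hsum s subset_rfl]
    exact Finset.sum_le_sum_of_subset_of_nonneg hsT fun j _ _ => hnn j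

lemma jointLaw_compl_rejSparse_le {ε τ : ℝ} (hS : IsSparseAggMaximizer N S) (hn : 0 < n)
    (hN : 0 < N) (hp : 1 < p) (hε0 : 0 < ε) (hε1 : ε ≤ 1) (hτ : 0 < τ)
    (hNε : N ≤ 2 * (p * ε))
    (h1 : 40 * Real.sqrt (Real.log p) ≤ phiOne * (Real.sqrt n * τ))
    (h2 : 160 * Real.sqrt (Real.log p) ≤ phiOne * (Real.sqrt n * Real.sqrt N * τ ^ 2)) :
    (jointLaw n p ε τ).real {ω | dataMap ω ∉ rejSparse N S} ≤
      4 / (p * ε) + (Real.log p)⁻¹ := by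
  have hn' : (1 : ℝ) ≤ n := by exact_mod_cast hn
  have hN' : (1 : ℝ) ≤ N := by exact_mod_cast hN
  have hL : 0 < Real.log p := Real.log_pos (by exact_mod_cast hp)
  have hNp : N ≤ p := by
    rw [← (hS 0).1]
    simpa using Finset.card_le_univ (S 0)
  refine jointLaw_real_le (by omega) hε0 hε1 hτ
    (measurable_dataMap (measurableSet_rejSparse hS).compl) (by positivity) fun ℓ hℓ μ hμ => ?_
  set t := Real.sqrt (2 * n * (N + 2) * Real.log p) with ht
  have ht2 : t ^ 2 = 2 * n * (N + 2) * Real.log p := Real.sq_sqrt (by positivity)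
  have ht0 : 0 < t := Real.sqrt_pos.2 (by positivity)
  obtain ⟨T, hT, hTμ⟩ := exists_card_eq_le_sum hμ hτ hNp hNε
  have hTne : T.Nonempty := Finset.card_pos.1 (hT ▸ hN)
  set a := (Real.sqrt T.card)⁻¹ * ∑ j ∈ T, μ j with ha
  have hsN : 0 < Real.sqrt N := Real.sqrt_pos.2 (by linarith)
  have hsNN : Real.sqrt N * Real.sqrt N = N := Real.mul_self_sqrt (by positivity)
  have hsn : 0 < Real.sqrt n := Real.sqrt_pos.2 (by linarith)
  have hsnn : Real.sqrt n * Real.sqrt n = n := Real.mul_self_sqrt (by positivity)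
  have haN : Real.sqrt N * τ / 4 ≤ a := by
    rw [ha, hT, inv_mul_eq_div, le_div_iff₀ hsN]
    refine le_trans (le_of_eq ?_) hTμ
    linear_combination (τ / 4) * hsNN
  have ha0 : 0 < a := lt_of_lt_of_le (by positivity) haN
  have hsub : {Z : Fin n → Fin p → ℝ |
        (ℓ, μ, Z) ∈ (dataMap : Omega n p → _) ⁻¹' (rejSparse N S)ᶜ} ⊆
      {Z | (fun i => (Real.sqrt T.card)⁻¹ * ∑ j ∈ T, dataMap (ℓ, μ, Z) i j) ∈
        {w : Fin n → ℝ | ∑ i, |w i| < Real.sqrt (2 / Real.pi) * n + t}} := by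
    intro Z hZ
    by_contra hcon
    refine hZ ?_
    exact (mem_rejSparse_iff hS).2 ⟨T, hT, not_lt.1 hcon⟩
  refine (measureReal_mono hsub).trans ?_
  rw [noiseLaw_real_row_sums hTne (measurableSet_lt (by fun_prop) measurable_const), ← ha]
  have hgain : 2 * t ≤ n * (phiOne / 2 * (a * min a 1)) := by
    have htM : t ≤ 5 / 2 * (Real.sqrt n * Real.sqrt N * Real.sqrt (Real.log p)) := by
      rw [ht, Real.sqrt_le_left (by positivity), mul_pow, mul_pow, mul_pow,
        Real.sq_sqrt (by positivity), Real.sq_sqrt (by positivity), Real.sq_sqrt hL.le]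
      have : 0 < n * Real.log p := by positivity
      nlinarith
    have hnN : 0 < Real.sqrt n * Real.sqrt N := by positivity
    have hφ := phiOne_pos
    rcases le_total a 1 with h | h
    · rw [min_eq_left h]
      have ha2 := mul_le_mul haN haN (by positivity) ha0.le
      have hna := mul_le_mul_of_nonneg_left ha2 (show 0 ≤ n * (phiOne / 2) by positivity)
      have h3 := mul_le_mul_of_nonneg_left h2 hnN.le
      have e : n * (phiOne / 2) * (Real.sqrt N * τ / 4 * (Real.sqrt N * τ / 4)) =
          Real.sqrt n * Real.sqrt N * (phiOne * (Real.sqrt n * Real.sqrt N * τ ^ 2)) / 32 := by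
        linear_combination (-phiOne * Real.sqrt N ^ 2 * τ ^ 2 / 32) * hsnn
      linarith
    · rw [min_eq_right h, mul_one]
      have hna := mul_le_mul_of_nonneg_left haN (show 0 ≤ n * (phiOne / 2) by positivity)
      have h3 := mul_le_mul_of_nonneg_left h1 hnN.le
      have e : n * (phiOne / 2) * (Real.sqrt N * τ / 4) =
          Real.sqrt n * Real.sqrt N * (phiOne * (Real.sqrt n * τ)) / 8 := by
        linear_combination (-phiOne * Real.sqrt N * τ / 8) * hsnn
      linarith
  have hcheb := measureReal_pi_sum_lt_le (ν := fun _ : Fin n => gaussianReal 0 1)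
    (f := fun i x => |ℓ i * a + x|) (fun i => memLp_abs_const_add _) (V := 1)
    (fun i => variance_abs_const_add_le _)
    (t := t) (s := Real.sqrt (2 / Real.pi) * n + t) ht0 (by
      have hi (i : Fin n) : Real.sqrt (2 / Real.pi) + phiOne / 2 * (a * min a 1) ≤
          ∫ x, |ℓ i * a + x| ∂(gaussianReal 0 1) := by
        have habs : |ℓ i * a| = a := by
          rcases hℓ i with h | h <;> rw [h] <;> simp [abs_of_pos ha0]
        have := le_integral_abs_const_add (ℓ i * a)
        rwa [habs] at this
      have hs := Finset.sum_le_sum fun i (_ : i ∈ (Finset.univ : Finset (Fin n))) => hi i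
      rw [Finset.sum_const, Finset.card_univ, Fintype.card_fin, nsmul_eq_mul] at hs
      refine le_trans ?_ hs
      linarith)
  refine hcheb.trans ?_
  rw [Fintype.card_fin, ht2, ← one_div, div_le_div_iff₀ (by positivity) hL]
  have : 0 ≤ n * Real.log p := by positivity
  nlinarith

end SparseAggregation

section Asymptotics

lemma eventually_const_mul_sqrt_log_le {δ : ℝ} (hδ : 0 < δ) (C : ℝ) :
    ∀ᶠ p : ℕ in atTop, C * Real.sqrt (Real.log p) ≤ (p : ℝ) ^ δ := by
  have h := (isLittleO_log_rpow_atTop (show 0 < 2 * δ by positivity)).bound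
    (show 0 < 1 / (C ^ 2 + 1) by positivity)
  filter_upwards [tendsto_natCast_atTop_atTop.eventually h, eventually_ge_atTop 1] with p hp hp1
  have hp0 : (0 : ℝ) ≤ p := by positivity
  have hlog : 0 ≤ Real.log p := Real.log_natCast_nonneg p
  rw [Real.norm_of_nonneg hlog, Real.norm_of_nonneg (by positivity), one_div,
    inv_mul_eq_div, le_div_iff₀ (by positivity)] at hp
  refine le_of_sq_le_sq ?_ (by positivity)
  rw [mul_pow, Real.sq_sqrt hlog, ← Real.rpow_mul_natCast hp0]
  rw [mul_comm 2 δ] at hp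
  push_cast
  nlinarith

lemma rpow_half_le_sqrt {x a y : ℝ} (hx : 0 ≤ x) (h : x ^ a ≤ y) :
    x ^ (a / 2) ≤ Real.sqrt y := by
  refine Real.le_sqrt_of_sq_le ?_
  rw [← Real.rpow_mul_natCast hx]
  simpa using h

lemma tendsto_natCast_rpow_atTop {δ : ℝ} (hδ : 0 < δ) :
    Tendsto (fun p : ℕ => (p : ℝ) ^ δ) atTop atTop :=
  (tendsto_rpow_atTop hδ).comp tendsto_natCast_atTop_atTop

lemma tendsto_log_natCast_atTop : Tendsto (fun p : ℕ => Real.log p) atTop atTop :=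
  Real.tendsto_log_atTop.comp tendsto_natCast_atTop_atTop

lemma testErr_nonneg (n p : ℕ) (ε τ : ℝ) (R : Set (Fin n → Fin p → ℝ)) :
    0 ≤ testErr n p ε τ R := by
  unfold testErr
  positivity

variable {α β θ : ℝ}

lemma nDim_pos {p : ℕ} (hp : 0 < p) : 0 < nDim p θ :=
  Nat.ceil_pos.2 (by positivity)

lemma rpow_half_le_sqrt_nDim (p : ℕ) (θ : ℝ) : (p : ℝ) ^ (θ / 2) ≤ Real.sqrt (nDim p θ) :=
  rpow_half_le_sqrt (by positivity) (Nat.le_ceil _)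

lemma mul_rpow_neg {p : ℕ} (hp : 0 < p) : (p : ℝ) * (p : ℝ) ^ (-β) = (p : ℝ) ^ (1 - β) := by
  rw [sub_eq_add_neg, Real.rpow_add (by positivity), Real.rpow_one]

theorem tendsto_testErr_rejSA (hβ0 : 0 < β) (hβ1 : β < 1) (hα : α < etaHyp1 θ β) :
    Tendsto (fun p : ℕ => testErr (nDim p θ) p ((p : ℝ) ^ (-β)) ((p : ℝ) ^ (-α)) rejSA)
      atTop (nhds 0) := by
  set d := θ / 2 + 1 - 2 * β - 2 * α with hd
  have hd0 : 0 < d := by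
    unfold etaHyp1 at hα
    linarith
  have hlim : Tendsto (fun p : ℕ => fourthMoment / (8 * Real.log p) +
      (4 / (p : ℝ) ^ (1 - β) + (32 + 8 * fourthMoment) / ((p : ℝ) ^ d / 4))) atTop (nhds 0) := by
    have h1 := (tendsto_log_natCast_atTop.const_mul_atTop
      (show (0 : ℝ) < 8 by norm_num)).const_div_atTop fourthMoment
    have h2 := (tendsto_natCast_rpow_atTop (show 0 < 1 - β by linarith)).const_div_atTop 4
    have h3 := ((tendsto_natCast_rpow_atTop hd0).atTop_div_const
      (show (0 : ℝ) < 4 by norm_num)).const_div_atTop (32 + 8 * fourthMoment)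
    simpa using h1.add (h2.add h3)
  refine squeeze_zero' (Eventually.of_forall fun p => testErr_nonneg _ _ _ _ _) ?_ hlim
  filter_upwards [eventually_gt_atTop 1, eventually_const_mul_sqrt_log_le hd0 32,
    (tendsto_natCast_rpow_atTop hd0).eventually_ge_atTop 4] with p hp hlog h4
  have hp0 : (0 : ℝ) < p := by positivity
  have hp1 : (1 : ℝ) ≤ p := by exact_mod_cast hp.le
  have hn : 0 < nDim p θ := nDim_pos (by omega)
  rw [← mul_rpow_neg (show 0 < p by omega)]
  refine add_le_add (noiseLaw_rejSA_le hn hp) (jointLaw_compl_rejSA_le hn hp (by positivity)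
    (Real.rpow_le_one_of_one_le_of_nonpos hp1 (by linarith)) (by positivity) (by linarith)
    (by linarith) ?_)
  calc (p : ℝ) ^ d / 4
      = (p : ℝ) ^ (θ / 2) * (p * ((p : ℝ) ^ (-β)) ^ 2 * ((p : ℝ) ^ (-α)) ^ 2 / 4) := by
        rw [← Real.rpow_mul_natCast hp0.le, ← Real.rpow_mul_natCast hp0.le, hd,
          show θ / 2 + 1 - 2 * β - 2 * α = θ / 2 + 1 + -β * (2 : ℕ) + -α * (2 : ℕ) by
            push_cast; ring,
          Real.rpow_add hp0, Real.rpow_add hp0, Real.rpow_add hp0, Real.rpow_one]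
        ring
    _ ≤ _ := by
        gcongr
        exact rpow_half_le_sqrt_nDim p θ

theorem tendsto_testErr_rejSparse (hβ0 : 0 < β) (hβ1 : β < 1) (hα : α < etaHyp2 θ β)
    {Shat : (p : ℕ) → (Fin (nDim p θ) → Fin p → ℝ) → Finset (Fin p)}
    (hS : ∀ p : ℕ, IsSparseAggMaximizer ⌈(p : ℝ) * (p : ℝ) ^ (-β)⌉₊ (Shat p)) :
    Tendsto (fun p : ℕ => testErr (nDim p θ) p ((p : ℝ) ^ (-β)) ((p : ℝ) ^ (-α))
      (rejSparse ⌈(p : ℝ) * (p : ℝ) ^ (-β)⌉₊ (Shat p))) atTop (nhds 0) := by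
  have hφ := phiOne_pos
  obtain ⟨hα1, hα2⟩ := lt_min_iff.1 hα
  have hd1 : 0 < θ / 2 - α := by linarith
  have hd2 : 0 < θ / 2 + (1 - β) / 2 - 2 * α := by linarith
  have hlim : Tendsto (fun p : ℕ => ((p : ℝ) ^ 2)⁻¹ + (4 / (p : ℝ) ^ (1 - β) +
      (Real.log p)⁻¹)) atTop (nhds 0) := by
    have h1 := ((tendsto_pow_atTop two_ne_zero).comp
      (tendsto_natCast_atTop_atTop (R := ℝ))).inv_tendsto_atTop
    have h2 := (tendsto_natCast_rpow_atTop (show 0 < 1 - β by linarith)).const_div_atTop 4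
    have h3 := tendsto_log_natCast_atTop.inv_tendsto_atTop
    simpa using h1.add (h2.add h3)
  refine squeeze_zero' (Eventually.of_forall fun p => testErr_nonneg _ _ _ _ _) ?_ hlim
  filter_upwards [eventually_gt_atTop 1, eventually_const_mul_sqrt_log_le hd1 (40 / phiOne),
    eventually_const_mul_sqrt_log_le hd2 (160 / phiOne)] with p hp hlog1 hlog2
  have hp0 : (0 : ℝ) < p := by positivity
  have hp1 : (1 : ℝ) ≤ p := by exact_mod_cast hp.le
  have hn : 0 < nDim p θ := nDim_pos (by omega)
  have hpε : 1 ≤ (p : ℝ) * (p : ℝ) ^ (-β) := by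
    rw [mul_rpow_neg (by omega)]
    exact Real.one_le_rpow hp1 (by linarith)
  have hN : 0 < ⌈(p : ℝ) * (p : ℝ) ^ (-β)⌉₊ := Nat.ceil_pos.2 (by linarith)
  have hsN : (p : ℝ) ^ ((1 - β) / 2) ≤ Real.sqrt ⌈(p : ℝ) * (p : ℝ) ^ (-β)⌉₊ := by
    refine rpow_half_le_sqrt hp0.le ?_
    rw [← mul_rpow_neg (by omega)]
    exact Nat.le_ceil _
  have hsn := rpow_half_le_sqrt_nDim p θ
  rw [div_mul_eq_mul_div, div_le_iff₀' hφ] at hlog1 hlog2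
  rw [← mul_rpow_neg (show 0 < p by omega)]
  refine add_le_add (noiseLaw_rejSparse_le (hS p) hn hN (by omega))
    (jointLaw_compl_rejSparse_le (hS p) hn hN hp (by positivity)
      (Real.rpow_le_one_of_one_le_of_nonpos hp1 (by linarith)) (by positivity) ?_
      (hlog1.trans ?_) (hlog2.trans ?_))
  · have := (Nat.ceil_lt_add_one (show 0 ≤ (p : ℝ) * (p : ℝ) ^ (-β) by linarith)).le
    linarith
  · rw [sub_eq_add_neg, Real.rpow_add hp0]
    gcongr
  · rw [show θ / 2 + (1 - β) / 2 - 2 * α = θ / 2 + (1 - β) / 2 + -α * (2 : ℕ) by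
        push_cast; ring,
      Real.rpow_add hp0, Real.rpow_add hp0, Real.rpow_mul_natCast hp0.le]
    gcongr

end Asymptotics

end ARWPaper

open ARWPaper Filter in
/-- statistical upper bound for global hypothesis testing. If
`α < η^hyp_θ(β)` then (i) the Simple Aggregation test succeeds when
`α < η^{hyp,1}_θ(β)`, and (ii) the Sparse Aggregation test with `N = ⌈p ε_p⌉`
succeeds when `α < η^{hyp,2}_θ(β)`. -/
theorem hypothesis_testing_upper_bound
    (α β θ : ℝ) (hα0 : 0 < α) (hα1 : α < 1) (hβ0 : 0 < β) (hβ1 : β < 1)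
    (hθ0 : 0 < θ) (hθ1 : θ < 1) (hmain : α < etaHyp θ β) :
    (α < etaHyp1 θ β →
      Tendsto
        (fun p : ℕ => testErr (nDim p θ) p ((p : ℝ) ^ (-β)) ((p : ℝ) ^ (-α)) rejSA)
        atTop (nhds 0)) ∧
    (α < etaHyp2 θ β →
      ∀ Shat : (p : ℕ) → (Fin (nDim p θ) → Fin p → ℝ) → Finset (Fin p),
        (∀ p : ℕ, IsSparseAggMaximizer ⌈(p : ℝ) * (p : ℝ) ^ (-β)⌉₊ (Shat p)) →
        Tendsto
          (fun p : ℕ =>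
            testErr (nDim p θ) p ((p : ℝ) ^ (-β)) ((p : ℝ) ^ (-α))
              (rejSparse ⌈(p : ℝ) * (p : ℝ) ^ (-β)⌉₊ (Shat p)))
          atTop (nhds 0)) := by
  exact ⟨tendsto_testErr_rejSA hβ0 hβ1, fun h _ hS => tendsto_testErr_rejSparse hβ0 hβ1 h hS⟩
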